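/- If the toric algebra A_E is consistent, then for every arrow a ∈ Q₁ the labelling monomial x^{div(a)} divides the anticanonical monomial ∏_{ρ∈σ(1)} x_ρ. -/

import Mathlib

namespace NCCell
/-- Toric data for a normal affine toric variety `X = Spec k[σ^∨ ∩ M]` of dimension `n`
with a torus-invariant point: the strongly convex, full-dimensional rational cone
`σ ⊆ ℝⁿ` is recorded through the primitive generators `v ρ` of its `d` extremal rays. -/
structure ToricData (n d : ℕ) where
  v : Fin d → Fin n → ℤ
  primitive : ∀ ρ, Finset.univ.gcd (fun i => (v ρ i).natAbs) = 1
  strongly_convex : ∃ u : Fin n → ℤ, ∀ ρ, 0 < ∑ i, u i * v ρ i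
  full_dim : ∀ u : Fin n → ℤ, (∀ ρ, ∑ i, u i * v ρ i = 0) → u = 0
  extremal_rays : ∀ ρ : Fin d, ∃ u : Fin n → ℤ,
    (∑ i, u i * v ρ i = 0) ∧ ∀ ρ', ρ' ≠ ρ → 0 < ∑ i, u i * v ρ' i

namespace ToricData
variable {n d : ℕ} (T : ToricData n d)
/-- The inclusion `M = ℤⁿ → ℤᵈ`, `u ↦ (⟨u, v_ρ⟩)_ρ`, from the exact sequence
`0 → M → ℤᵈ → Cl(X) → 0`. -/
def iota : (Fin n → ℤ) →+ (Fin d → ℤ) where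
  toFun u := fun ρ => ∑ i, u i * T.v ρ i
  map_zero' := by funext ρ; simp
  map_add' u w := by funext ρ; simp [add_mul, Finset.sum_add_distrib]
/-- The sublattice of `ℤᵈ` of principal torus-invariant Weil divisors, i.e. the image
of `M`; the class group `Cl(X)` is the quotient `ℤᵈ ⧸ prin`. -/
def prin : AddSubgroup (Fin d → ℤ) := T.iota.range
/-- `X` is Gorenstein: `(1,…,1)` lies in (the image of) `M`. -/
def Gorenstein : Prop := (fun _ => 1 : Fin d → ℤ) ∈ T.prin
end ToricData

def toInt {d : ℕ} (u : Fin d → ℕ) : Fin d → ℤ := fun ρ => (u ρ : ℤ)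

/-- A collection of distinct rank one reflexive sheaves on `X`, recorded through Weil
divisor representatives `D i` of their divisor classes. -/
structure Collection {n d : ℕ} (T : ToricData n d) (I : Type*) where
  D : I → Fin d → ℤ
  distinct : ∀ i j : I, D i - D j ∈ T.prin → i = j

namespace Collection
section
variable {n d : ℕ} {T : ToricData n d} {I : Type*} (C : Collection T I)
/-- `u ∈ ℕᵈ` is (the divisor of zeroes of) a torus-invariant section of
`Hom(E_i, E_j) = H⁰(X, O_X(D_j - D_i))`, i.e. `u` is effective of class `[D_j - D_i]`. -/
def IsSection (i j : I) (u : Fin d → ℕ) : Prop :=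
  toInt u - (C.D j - C.D i) ∈ T.prin
/-- A torus-invariant section is irreducible if it admits no nontrivial factorisation
through a member of the collection. -/
def IsIrreducible (i j : I) (u : Fin d → ℕ) : Prop :=
  C.IsSection i j u ∧
    ∀ (l : I) (u₁ u₂ : Fin d → ℕ), u = u₁ + u₂ →
      C.IsSection i l u₂ → C.IsSection l j u₁ →
      (l = i ∧ u₂ = 0) ∨ (l = j ∧ u₁ = 0)
/-- An arrow of the quiver of sections `Q` of the collection: an irreducible
torus-invariant section, with its head, tail and labelling divisor `div(a) ∈ ℕᵈ`. -/
structure Arrow where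
  src : I
  tgt : I
  lab : Fin d → ℕ
  irred : C.IsIrreducible src tgt lab
  nontriv : ¬ (src = tgt ∧ lab = 0)
/-- Paths in the quiver of sections (`nil i` is the trivial path `e_i`, and
`cons p a _` is the path `a·p`, i.e. `a` traversed last). -/
inductive Path : I → I → Type _
  | nil (i : I) : Path i i
  | cons {i j : I} (p : Path i j) (a : C.Arrow) (h : a.src = j) : Path i a.tgt
end

section
variable {n d : ℕ} {T : ToricData n d} {I : Type*} {C : Collection T I}
/-- The labelling divisor `div(p) ∈ ℕᵈ` of a path. -/
def Path.lab {i : I} : {j : I} → C.Path i j → (Fin d → ℕ)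
  | _, .nil _ => 0
  | _, .cons p a _ => Path.lab p + a.lab
/-- Composition of paths: `p.comp q` traverses `p` first, then `q`. -/
def Path.comp {i j : I} (p : C.Path i j) : {l : I} → C.Path j l → C.Path i l
  | _, .nil _ => p
  | _, .cons q a h => .cons (Path.comp p q) a h
/-- The arrow traversed last by a path. -/
def Path.lastArrow? {i : I} : {j : I} → C.Path i j → Option (C.Arrow)
  | _, .nil _ => none
  | _, .cons _ a _ => some a
/-- The arrow traversed first by a path. -/
def Path.firstArrow? {i : I} : {j : I} → C.Path i j → Option (C.Arrow)
  | _, .nil _ => none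
  | _, .cons p a _ => some ((Path.firstArrow? p).getD a)
/-- The list of arrows traversed by a path (last traversed first). -/
def Path.arrows {i : I} : {j : I} → C.Path i j → List (C.Arrow)
  | _, .nil _ => []
  | _, .cons p a _ => a :: Path.arrows p

/-- `pp - pm` is one of the generating relations of the ideal of superpotential
relations `J_W`: there is a path `q` such that the derivative `∂_q W` of the
superpotential `W = Σ_{p anticanonical cycle} p` is the sum of precisely the two paths
`pp` and `pm`, and these two paths share neither initial nor final arrow.  (Here
`∂_q W` is the sum of all paths `p` with tail at `h(q)`, head at `t(q)` and labelling
monomial `x^{div p} = Π_ρ x_ρ / x^{div q}`.) -/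
def IsSPRel {i j : I} (pp pm : C.Path i j) : Prop :=
  ∃ q : C.Path j i,
    (∀ ρ, pp.lab ρ + q.lab ρ = 1) ∧ (∀ ρ, pm.lab ρ + q.lab ρ = 1) ∧
    pp ≠ pm ∧
    pp.firstArrow? ≠ pm.firstArrow? ∧ pp.lastArrow? ≠ pm.lastArrow? ∧
    (∀ p : C.Path i j, (∀ ρ, p.lab ρ + q.lab ρ = 1) → p = pp ∨ p = pm)

/-- F-term equivalence of paths: the equivalence relation generated by
`q₂ p₊ q₁ ∼ q₂ p₋ q₁` for superpotential relations `p₊ - p₋ ∈ J_W`.  Two paths are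
identified in the superpotential algebra `A_W = kQ/J_W` iff they are F-term equivalent. -/
inductive FTermEquiv : {i j : I} → C.Path i j → C.Path i j → Prop
  | rel {i j l m : I} {pp pm : C.Path i j} (q₁ : C.Path l i) (q₂ : C.Path j m)
      (h : IsSPRel pp pm) :
      FTermEquiv ((q₁.comp pp).comp q₂) ((q₁.comp pm).comp q₂)
  | refl {i j : I} (p : C.Path i j) : FTermEquiv p p
  | symm {i j : I} {p q : C.Path i j} : FTermEquiv p q → FTermEquiv q p
  | trans {i j : I} {p q r : C.Path i j} : FTermEquiv p q → FTermEquiv q r → FTermEquiv p r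
end

/-- The toric algebra `A_𝓔 = kQ/J_𝓔` is consistent, i.e. `J_𝓔 = J_W`: since (classes of)
paths form bases of both quotient algebras, this says precisely that two paths of `Q`
with the same head and tail are identified in `A_𝓔` (i.e. share the same labelling
divisor) if and only if they are identified in `A_W` (i.e. are F-term equivalent). -/
def Consistent {n d : ℕ} {T : ToricData n d} {I : Type*} (C : Collection T I) : Prop :=
  ∀ (i j : I) (p q : C.Path i j), p.lab = q.lab ↔ FTermEquiv p q

end Collection
end NCCell

namespace NCCell.Collection
variable {n d : ℕ} {T : ToricData n d} {I : Type*} {C : Collection T I}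

theorem IsSection.eq_of_zero {i j : I} (h : C.IsSection i j 0) : i = j := by
  apply C.distinct
  have h0 : toInt (0 : Fin d → ℕ) = 0 := by funext ρ; simp [toInt]
  simpa [IsSection, h0] using h

theorem Arrow.lab_ne_zero (a : C.Arrow) : a.lab ≠ 0 := fun h =>
  a.nontriv ⟨IsSection.eq_of_zero (h ▸ a.irred.1), h⟩

theorem Path.lab_comp {i j l : I} (p : C.Path i j) (q : C.Path j l) :
    (p.comp q).lab = p.lab + q.lab := by
  induction q with
  | nil => simp [Path.comp, Path.lab]
  | cons q a h ih => simp [Path.comp, Path.lab, ih, add_assoc]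

theorem Path.lastArrow?_eq_none {i j : I} {p : C.Path i j} (h : p.lastArrow? = none) :
    p.lab = 0 := by
  cases p with
  | nil => rfl
  | cons p a h' => simp [Path.lastArrow?] at h

theorem Path.lastArrow?_of_lab_eq_zero {i j : I} {p : C.Path i j} (h : p.lab = 0) :
    p.lastArrow? = none := by
  cases p with
  | nil => rfl
  | cons p a h' =>
    refine absurd ?_ a.lab_ne_zero
    funext ρ
    have := congrFun h ρ
    simp only [Path.lab, Pi.add_apply, Pi.zero_apply] at this ⊢
    omega

theorem Path.lab_le_of_lastArrow? {i j : I} {p : C.Path i j} {a : C.Arrow}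
    (h : p.lastArrow? = some a) (ρ : Fin d) : a.lab ρ ≤ p.lab ρ := by
  cases p with
  | nil => simp [Path.lastArrow?] at h
  | cons p b h' =>
    obtain rfl : b = a := by simpa [Path.lastArrow?] using h
    simp [Path.lab]

/-- The last arrow of a composite is that of the second path, unless the latter is trivial. -/
theorem Path.lastArrow?_comp {i j l : I} (p : C.Path i j) (q : C.Path j l) :
    (p.comp q).lastArrow? = q.lastArrow?.or p.lastArrow? := by
  cases q <;> simp [Path.comp, Path.lastArrow?]

/-- Every torus-invariant section is the label of a path. -/
theorem IsSection.exists_path {i j : I} {u : Fin d → ℕ} (h : C.IsSection i j u) :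
    ∃ p : C.Path i j, p.lab = u := by
  induction hN : ∑ ρ, u ρ using Nat.strong_induction_on generalizing i j u with
  | _ N ih =>
  by_cases hu : u = 0
  · subst hu
    obtain rfl := h.eq_of_zero
    exact ⟨.nil i, rfl⟩
  by_cases hirr : C.IsIrreducible i j u
  · exact ⟨.cons (.nil i) ⟨i, j, u, hirr, fun h => hu h.2⟩ rfl, by simp [Path.lab]⟩
  have hsplit : ∃ (l : I) (u₁ u₂ : Fin d → ℕ), u = u₁ + u₂ ∧ C.IsSection i l u₂ ∧
      C.IsSection l j u₁ ∧ ¬ ((l = i ∧ u₂ = 0) ∨ (l = j ∧ u₁ = 0)) := by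
    by_contra hcon
    refine hirr ⟨h, fun l u₁ u₂ e h₂ h₁ => ?_⟩
    by_contra hne
    exact hcon ⟨l, u₁, u₂, e, h₂, h₁, hne⟩
  obtain ⟨l, u₁, u₂, rfl, h₂, h₁, hne⟩ := hsplit
  have hpos : ∀ w : Fin d → ℕ, w ≠ 0 → 0 < ∑ ρ, w ρ := fun w hw => by
    refine Nat.pos_of_ne_zero fun hs => hw ?_
    funext ρ
    exact (Finset.sum_eq_zero_iff.mp hs) ρ (Finset.mem_univ ρ)
  have hp₁ := hpos u₁ fun h0 => hne (.inr ⟨(h0 ▸ h₁).eq_of_zero, h0⟩)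
  have hp₂ := hpos u₂ fun h0 => hne (.inl ⟨(h0 ▸ h₂).eq_of_zero.symm, h0⟩)
  simp only [Pi.add_apply, Finset.sum_add_distrib] at hN
  obtain ⟨p, hp⟩ := ih _ (by omega) h₂ rfl
  obtain ⟨q, hq⟩ := ih _ (by omega) h₁ rfl
  exact ⟨p.comp q, by rw [Path.lab_comp, hp, hq, add_comm]⟩

/-- An arrow whose label does not divide the anticanonical monomial occurs in no
superpotential relation, so F-term equivalence cannot change whether it comes last. -/
theorem FTermEquiv.lastArrow?_eq_some_iff {a : C.Arrow} {ρ : Fin d} (ha : 1 < a.lab ρ)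
    {i j : I} {p q : C.Path i j} (h : FTermEquiv p q) :
    p.lastArrow? = some a ↔ q.lastArrow? = some a := by
  induction h with
  | refl => rfl
  | symm _ ih => exact ih.symm
  | trans _ _ ih₁ ih₂ => exact ih₁.trans ih₂
  | @rel i j l m pp pm q₁ q₂ h =>
    obtain ⟨q, hp, hm, -, -, hlast, -⟩ := h
    have hlab : pp.lab = pm.lab := funext fun ρ => by have := hp ρ; have := hm ρ; omega
    have hlast' : ∀ p : C.Path i j, (∀ ρ, p.lab ρ + q.lab ρ = 1) → p.lab ≠ 0 →
        (p.lastArrow?.or q₁.lastArrow?) ≠ some a := fun p hp h0 he => by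
      cases hb : p.lastArrow? with
      | none => exact h0 (Path.lastArrow?_eq_none hb)
      | some b =>
        obtain rfl : b = a := by simpa [hb] using he
        have := Path.lab_le_of_lastArrow? hb ρ
        have := hp ρ
        omega
    have hpp : pp.lab ≠ 0 := fun h0 => hlast <| by
      rw [Path.lastArrow?_of_lab_eq_zero h0, Path.lastArrow?_of_lab_eq_zero (hlab ▸ h0)]
    simp only [Path.lastArrow?_comp]
    cases q₂.lastArrow? with
    | some b => simp
    | none => simp only [Option.none_or, hlast' pp hp hpp, hlast' pm hm (hlab ▸ hpp)]

/-- On a Gorenstein variety there is an anticanonical cycle at every vertex. -/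
theorem exists_anticanonical_cycle (hGor : T.Gorenstein) (i : I) :
    ∃ p : C.Path i i, p.lab = fun _ => 1 :=
  IsSection.exists_path <| by
    have h1 : toInt (fun _ : Fin d => 1) = fun _ => 1 := by funext ρ; simp [toInt]
    simpa only [IsSection, ToricData.Gorenstein, h1, sub_self, sub_zero] using hGor

end NCCell.Collection

open NCCell Collection

/-- Proposition 3.5: if the toric algebra `A_𝓔` of a collection `𝓔`
on the Gorenstein affine toric variety `X` is consistent, then for every arrow `a` of
the quiver of sections the labelling monomial `x^{div a}` divides `Π_{ρ ∈ σ(1)} x_ρ`. -/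
theorem consistent_label_divides_anticanonical
    {n d : ℕ} (T : ToricData n d) (hGor : T.Gorenstein) {r : ℕ}
    (C : Collection T (Fin (r + 1))) (hD₀ : C.D 0 = 0)
    (hcon : C.Consistent) :
    ∀ a : C.Arrow, ∀ ρ : Fin d, a.lab ρ ≤ 1 := by
  intro a ρ
  by_contra! ha
  obtain ⟨c, hc⟩ := C.exists_anticanonical_cycle hGor a.src
  obtain ⟨c', hc'⟩ := C.exists_anticanonical_cycle hGor a.tgt
  have he : FTermEquiv (Path.cons c a rfl) ((Path.cons (.nil a.src) a rfl).comp c') := by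
    rw [← hcon, Path.lab_comp]
    simp [Path.lab, hc, hc', add_comm]
  have hlast := (he.lastArrow?_eq_some_iff ha).mp rfl
  rw [Path.lastArrow?_comp] at hlast
  cases hb : c'.lastArrow? with
  | none => simpa [hc'] using congrFun (Path.lastArrow?_eq_none hb) ρ
  | some b =>
    obtain rfl : b = a := by simpa [hb] using hlast
    have := Path.lab_le_of_lastArrow? hb ρ
    simp only [hc'] at this
    omega
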